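/- arXiv:2205.11054 — 2 statements merged into one kernel-verified Lean document; each statement's English description precedes it below -/
import Mathlib

section
/- Let (T, F) be a pretorsion theory in a lextensive category C. Then F is closed under complemented subobjects: if the coproduct X + Y belongs to F, then both X and Y belong to F. -/
/- Basic notions of pretorsion theories, after Borceux, Campanini, Gran,
"Pretorsion theories in lextensive categories". -/

namespace PretorsionPaper

open CategoryTheory CategoryTheory.Limits

universe w₂ w₁ v' u' v u

variable {C : Type u} [Category.{v} C]

/-- A morphism is `Z`-trivial if it factors through an object of `Z`. -/
def IsTrivial (Z : Set C) {X Y : C} (f : X ⟶ Y) : Prop :=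
  ∃ (W : C) (g : X ⟶ W) (h : W ⟶ Y), W ∈ Z ∧ g ≫ h = f

/-- `ε : K ⟶ A` is a `Z`-kernel of `f : A ⟶ B`. -/
structure IsZKernel (Z : Set C) {K A B : C} (ε : K ⟶ A) (f : A ⟶ B) : Prop where
  comp_trivial : IsTrivial Z (ε ≫ f)
  lift : ∀ {Y : C} (l : Y ⟶ A), IsTrivial Z (l ≫ f) → ∃! l' : Y ⟶ K, l' ≫ ε = l

/-- `q : B ⟶ Q` is a `Z`-cokernel of `f : A ⟶ B`. -/
structure IsZCokernel (Z : Set C) {A B Q : C} (q : B ⟶ Q) (f : A ⟶ B) : Prop where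
  comp_trivial : IsTrivial Z (f ≫ q)
  desc : ∀ {W : C} (h : B ⟶ W), IsTrivial Z (f ≫ h) → ∃! h' : Q ⟶ W, q ≫ h' = h

/-- A pretorsion theory `(T, F)` in a category `C`: two replete full subcategories
(given by their classes of objects) such that every morphism from `T` to `F` is
`Z`-trivial (`Z := T ∩ F`) and every object fits in a short `Z`-exact sequence
`T₀ ⟶ X ⟶ F₀` with `T₀ ∈ T`, `F₀ ∈ F`. -/
structure PretorsionTheory (C : Type u) [Category.{v} C] where
  T : Set C
  F : Set C
  replete_T : ∀ {X Y : C}, (X ≅ Y) → X ∈ T → Y ∈ T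
  replete_F : ∀ {X Y : C}, (X ≅ Y) → X ∈ F → Y ∈ F
  hom_trivial : ∀ {X Y : C}, X ∈ T → Y ∈ F → ∀ f : X ⟶ Y, IsTrivial (T ∩ F) f
  exact_seq : ∀ X : C, ∃ (T₀ F₀ : C) (e : T₀ ⟶ X) (h : X ⟶ F₀),
    T₀ ∈ T ∧ F₀ ∈ F ∧ IsZKernel (T ∩ F) e h ∧ IsZCokernel (T ∩ F) h e

/-- The class of trivial objects of a pretorsion theory. -/
def PretorsionTheory.Z (P : PretorsionTheory C) : Set C := P.T ∩ P.F

/-- A `Z`-cokernel is an epimorphism. -/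
theorem IsZCokernel.epi {Z : Set C} {A B Q : C} {q : B ⟶ Q} {f : A ⟶ B}
    (hq : IsZCokernel Z q f) : Epi q := by
  refine ⟨fun {W} a b hab => ?_⟩
  obtain ⟨V, g, k, hV, hgk⟩ := hq.comp_trivial
  have htriv : IsTrivial Z (f ≫ q ≫ a) :=
    ⟨V, g, k ≫ a, hV, by rw [← Category.assoc, hgk, Category.assoc]⟩
  exact (hq.desc (q ≫ a) htriv).unique rfl hab.symm

/-- The torsion-free class is closed under extremal subobjects. -/
theorem PretorsionTheory.mem_F_of_extremal (P : PretorsionTheory C) {A B : C} (m : A ⟶ B)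
    (hm : ∀ {Q : C} (q : A ⟶ Q) (n : Q ⟶ B), Epi q → q ≫ n = m → IsIso q)
    (hB : B ∈ P.F) : A ∈ P.F := by
  obtain ⟨T₀, F₀, e, q, hT, hF, -, hq⟩ := P.exact_seq A
  obtain ⟨n, hn, -⟩ := hq.desc m (P.hom_trivial hT hB _)
  have : IsIso q := hm q n hq.epi hn
  exact P.replete_F (asIso q).symm hF

/-- In a lextensive category, the square exhibiting `X` as the pullback of
`⊤_ C ⟶ ⊤_ C ⨿ ⊤_ C` along `X ⨿ Y ⟶ ⊤_ C ⨿ ⊤_ C`. -/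
theorem isPullback_inl_terminal [FinitaryExtensive C] [HasTerminal C] (X Y : C) :
    IsPullback (coprod.inl : X ⟶ X ⨿ Y) (terminal.from X)
      (coprod.map (terminal.from X) (terminal.from Y)) coprod.inl :=
  (((BinaryCofan.isVanKampen_iff _).mp
    (FinitaryExtensive.vanKampen _ (coprodIsCoprod (⊤_ C) (⊤_ C))) (BinaryCofan.mk
      (coprod.inl : X ⟶ X ⨿ Y) coprod.inr) (terminal.from X) (terminal.from Y)
      (coprod.map (terminal.from X) (terminal.from Y))
      (coprod.inl_map _ _).symm (coprod.inr_map _ _).symm).mp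
        ⟨coprodIsCoprod X Y⟩).1

/-- Coproduct coprojections in a lextensive category are extremal monomorphisms. -/
theorem isIso_of_epi_comp_eq_inl [FinitaryExtensive C] [HasTerminal C] {X Y Q : C}
    (q : X ⟶ Q) (n : Q ⟶ X ⨿ Y) [Epi q] (hn : q ≫ n = coprod.inl) : IsIso q := by
  have hpb := isPullback_inl_terminal X Y
  have hn' : n ≫ coprod.map (terminal.from X) (terminal.from Y) =
      terminal.from Q ≫ coprod.inl := by
    rw [← cancel_epi q, ← Category.assoc, hn, hpb.w, ← Category.assoc]
    congr 1
    exact Subsingleton.elim _ _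
  have : IsSplitMono q := ⟨⟨⟨hpb.lift n (terminal.from Q) hn', hpb.hom_ext
    (by rw [Category.assoc, hpb.lift_fst, hn, Category.id_comp]) (Subsingleton.elim _ _)⟩⟩⟩
  exact isIso_of_epi_of_isSplitMono q

theorem PretorsionTheory.mem_F_of_coprod_left [FinitaryExtensive C] [HasTerminal C]
    (P : PretorsionTheory C) {X Y : C} (h : (X ⨿ Y) ∈ P.F) : X ∈ P.F :=
  P.mem_F_of_extremal coprod.inl (fun q n _ hn => isIso_of_epi_comp_eq_inl q n hn) h

/-- in a lextensive category, `F` is closed under complemented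
subobjects: if `X ⨿ Y ∈ F` then `X ∈ F` and `Y ∈ F`. -/
theorem torsionFree_closed_complemented_subobjects
    [FinitaryExtensive C] [HasFiniteLimits C] (P : PretorsionTheory C)
    {X Y : C} (h : (X ⨿ Y) ∈ P.F) : X ∈ P.F ∧ Y ∈ P.F := by
  exact ⟨P.mem_F_of_coprod_left h,
    P.mem_F_of_coprod_left (P.replete_F (coprod.braiding X Y) h)⟩
end PretorsionPaper
end

section
/- Let C be a lextensive category with a pretorsion theory (T, F) such that Z := T ∩ F is closed under binary coproducts and under complemented subobjects. If k : K → X is a Z-kernel of a morphism f : X → Y in C, then Σ(k) is a kernel of Σ(f) in the pointed category Stab(C). -/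
/- Basic notions of pretorsion theories, after Borceux, Campanini, Gran,
"Pretorsion theories in lextensive categories". -/

namespace PretorsionPaper

open CategoryTheory CategoryTheory.Limits

universe w₂ w₁ v' u' v u

variable {C : Type u} [Category.{v} C]

/-- A morphism `β : B ⟶ Y` is a coproduct coprojection (equivalently, exhibits `B` as a
complemented subobject of `Y`) if there are `B'` and `β' : B' ⟶ Y` making `Y` a
coproduct of `B` and `B'` with coprojections `β`, `β'`. -/
def IsCoprodInclusion {B Y : C} (β : B ⟶ Y) : Prop :=
  ∃ (B' : C) (β' : B' ⟶ Y), Nonempty (IsColimit (BinaryCofan.mk β β'))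

/-- A representative of a partial morphism `X ⇀ Y`: a subobject-domain `dom` with an
inclusion `incl : dom ⟶ X` and a morphism `map : dom ⟶ Y`. -/
structure ParHom (X Y : C) where
  dom : C
  incl : dom ⟶ X
  map : dom ⟶ Y

/-- A partial morphism representative is valid when its inclusion is a complemented
subobject (a coproduct coprojection). -/
def ParHom.IsValid {X Y : C} (p : ParHom X Y) : Prop := IsCoprodInclusion p.incl

/-- The total partial morphism associated with an ordinary morphism (this is the
action of the functor `I : C ⟶ Par(C)`, and `Σ f` is its congruence class). -/
def ParHom.ofHom {X Y : C} (f : X ⟶ Y) : ParHom X Y := ⟨X, 𝟙 X, f⟩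

/-- Composition of partial morphism representatives, via the chosen pullback. -/
noncomputable def ParHom.comp [HasPullbacks C] {X Y W : C}
    (p : ParHom X Y) (q : ParHom Y W) : ParHom X W where
  dom := pullback p.map q.incl
  incl := pullback.fst p.map q.incl ≫ p.incl
  map := pullback.snd p.map q.incl ≫ q.map

/-- The zero partial morphism `X ⇀ Y`, factoring through the initial object. -/
noncomputable def ParHom.zero [HasInitial C] (X Y : C) : ParHom X Y :=
  ⟨⊥_ C, initial.to X, initial.to Y⟩

/-- The congruence relation on partial morphism representatives: there is a common
complemented subobject `Cm` of the two domains (with complements `C₁`, `C₂`),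
compatibly included in `X`, on which the two morphisms agree, and on the complements
the morphisms are `Z`-trivial. -/
def ParEquiv (Z : Set C) {X Y : C} (p q : ParHom X Y) : Prop :=
  ∃ (Cm C₁ C₂ : C) (γ₁ : Cm ⟶ p.dom) (δ₁ : C₁ ⟶ p.dom) (γ₂ : Cm ⟶ q.dom) (δ₂ : C₂ ⟶ q.dom),
    Nonempty (IsColimit (BinaryCofan.mk γ₁ δ₁)) ∧
    Nonempty (IsColimit (BinaryCofan.mk γ₂ δ₂)) ∧
    γ₁ ≫ p.incl = γ₂ ≫ q.incl ∧
    γ₁ ≫ p.map = γ₂ ≫ q.map ∧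
    IsTrivial Z (δ₁ ≫ p.map) ∧
    IsTrivial Z (δ₂ ≫ q.map)

/-- `k : K ⇀ X` is a kernel of `f : X ⇀ Y` in the pointed stable category: the
composite is the zero morphism, and every (valid) partial morphism whose composite
with `f` is zero factors through `k`, uniquely up to congruence. -/
def IsStabKernel [HasPullbacks C] [HasInitial C] (Z : Set C) {K X Y : C}
    (k : ParHom K X) (f : ParHom X Y) : Prop :=
  ParEquiv Z (k.comp f) (ParHom.zero K Y) ∧
  ∀ {N : C} (p : ParHom N X), p.IsValid → ParEquiv Z (p.comp f) (ParHom.zero N Y) →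
    ∃ u : ParHom N K, u.IsValid ∧ ParEquiv Z (u.comp k) p ∧
      ∀ u' : ParHom N K, u'.IsValid → ParEquiv Z (u'.comp k) p → ParEquiv Z u' u

/-- `c : Y ⇀ Q` is a cokernel of `f : X ⇀ Y` in the pointed stable category. -/
def IsStabCokernel [HasPullbacks C] [HasInitial C] (Z : Set C) {X Y Q : C}
    (f : ParHom X Y) (c : ParHom Y Q) : Prop :=
  ParEquiv Z (f.comp c) (ParHom.zero X Q) ∧
  ∀ {W : C} (h : ParHom Y W), h.IsValid → ParEquiv Z (f.comp h) (ParHom.zero X W) →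
    ∃ u : ParHom Q W, u.IsValid ∧ ParEquiv Z (c.comp u) h ∧
      ∀ u' : ParHom Q W, u'.IsValid → ParEquiv Z (c.comp u') h → ParEquiv Z u' u

theorem IsTrivial.precomp {Z : Set C} {W X Y : C} {f : X ⟶ Y} (hf : IsTrivial Z f) (g : W ⟶ X) :
    IsTrivial Z (g ≫ f) := by
  obtain ⟨V, a, b, hV, rfl⟩ := hf
  exact ⟨V, g ≫ a, b, hV, Category.assoc _ _ _⟩

theorem IsTrivial.postcomp {Z : Set C} {X Y W : C} {f : X ⟶ Y} (hf : IsTrivial Z f) (g : Y ⟶ W) :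
    IsTrivial Z (f ≫ g) := by
  obtain ⟨V, a, b, hV, rfl⟩ := hf
  exact ⟨V, a, b ≫ g, hV, (Category.assoc _ _ _).symm⟩

theorem isTrivial_of_mem {Z : Set C} {X Y : C} (hX : X ∈ Z) (f : X ⟶ Y) : IsTrivial Z f :=
  ⟨X, 𝟙 X, f, hX, Category.id_comp f⟩

/-- Triviality may be tested on the summands of a coproduct. -/
theorem isTrivial_of_isColimit [HasBinaryCoproducts C] {Z : Set C}
    (hZ : ∀ A B : C, A ∈ Z → B ∈ Z → (A ⨿ B) ∈ Z) {A B X Y : C} {a : A ⟶ X} {b : B ⟶ X}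
    (hc : IsColimit (BinaryCofan.mk a b)) {f : X ⟶ Y}
    (ha : IsTrivial Z (a ≫ f)) (hb : IsTrivial Z (b ≫ f)) : IsTrivial Z f := by
  obtain ⟨V, g, h, hV, hgh⟩ := ha
  obtain ⟨W, g', h', hW, hgh'⟩ := hb
  obtain ⟨l, hl, hl'⟩ : ∃ l : X ⟶ V ⨿ W, a ≫ l = g ≫ coprod.inl ∧ b ≫ l = g' ≫ coprod.inr :=
    let ⟨l, h⟩ := BinaryCofan.IsColimit.desc' hc (g ≫ coprod.inl) (g' ≫ coprod.inr)
    ⟨l, h⟩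
  refine ⟨V ⨿ W, l, coprod.desc h h', hZ V W hV hW, BinaryCofan.IsColimit.hom_ext hc ?_ ?_⟩
  · change a ≫ l ≫ coprod.desc h h' = a ≫ f
    rw [reassoc_of% hl, coprod.inl_desc, hgh]
  · change b ≫ l ≫ coprod.desc h h' = b ≫ f
    rw [reassoc_of% hl', coprod.inr_desc, hgh']

theorem PretorsionTheory.initial_mem_Z [HasInitial C] [HasBinaryCoproducts C]
    (P : PretorsionTheory C) (hZ : ∀ A B : C, (A ⨿ B) ∈ P.Z → A ∈ P.Z ∧ B ∈ P.Z) :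
    (⊥_ C) ∈ P.Z := by
  obtain ⟨T₀, F₀, e, h, -, -, hker, -⟩ := P.exact_seq (⊥_ C)
  obtain ⟨W, -, -, hW, -⟩ := hker.comp_trivial
  let i : W ≅ W ⨿ ⊥_ C := (coprod.rightUnitor W).symm
  exact (hZ W _ ⟨P.replete_T i hW.1, P.replete_F i hW.2⟩).2

/-- A `Z`-kernel is a monomorphism. -/
theorem IsZKernel.mono {Z : Set C} {K A B : C} {ε : K ⟶ A} {f : A ⟶ B} (h : IsZKernel Z ε f) :
    Mono ε where
  right_cancellation g g' hg :=
    (h.lift (g' ≫ ε) (by simpa using h.comp_trivial.precomp g')).unique hg rfl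

/-- `Z`-kernels reflect triviality. -/
theorem IsZKernel.isTrivial_of_comp {Z : Set C} {K A B Y : C} {ε : K ⟶ A} {f : A ⟶ B}
    (h : IsZKernel Z ε f) {g : Y ⟶ K} (hg : IsTrivial Z (g ≫ ε)) : IsTrivial Z g := by
  obtain ⟨W, a, b, hW, hab⟩ := hg
  obtain ⟨b', rfl, -⟩ := h.lift b (isTrivial_of_mem hW _)
  have := h.mono
  exact ⟨W, a, b', hW, by simpa [← cancel_mono ε] using hab⟩

/-- Coproduct decompositions are transported along isomorphisms. -/
theorem nonempty_isColimit_comp_iso {A B X Y : C} {a : A ⟶ X} {b : B ⟶ X}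
    (hc : Nonempty (IsColimit (BinaryCofan.mk a b))) (e : X ≅ Y) :
    Nonempty (IsColimit (BinaryCofan.mk (a ≫ e.hom) (b ≫ e.hom))) :=
  hc.map fun h => h.ofIsoColimit (BinaryCofan.ext e rfl rfl)

/-- An object is the coproduct of itself and the initial object. -/
theorem nonempty_isColimit_id_initial [HasInitial C] (X : C) :
    Nonempty (IsColimit (BinaryCofan.mk (𝟙 X) (initial.to X))) :=
  ⟨BinaryCofan.isColimitMk (fun s => s.inl) (fun s => Category.id_comp s.inl)
    (fun _ => Subsingleton.elim _ _) (fun _ m hm _ => (Category.id_comp m).symm.trans hm)⟩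

theorem nonempty_isColimit_initial_id [HasInitial C] (X : C) :
    Nonempty (IsColimit (BinaryCofan.mk (initial.to X) (𝟙 X))) :=
  ⟨BinaryCofan.isColimitMk (fun s => s.inr) (fun _ => Subsingleton.elim _ _)
    (fun s => Category.id_comp s.inr) (fun _ m _ hm => (Category.id_comp m).symm.trans hm)⟩

theorem ParEquiv.refl [HasInitial C] {Z : Set C} (h0 : (⊥_ C) ∈ Z) {X Y : C} (p : ParHom X Y) :
    ParEquiv Z p p :=
  ⟨_, _, _, _, _, _, _, nonempty_isColimit_id_initial _, nonempty_isColimit_id_initial _, rfl, rfl,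
    isTrivial_of_mem h0 _, isTrivial_of_mem h0 _⟩

/-- The congruence is invariant under isomorphism of the domain of the first representative. -/
theorem ParEquiv.of_iso_left {Z : Set C} {X Y : C} {p p' q : ParHom X Y} (h : ParEquiv Z p q)
    (e : p.dom ≅ p'.dom) (hincl : e.hom ≫ p'.incl = p.incl) (hmap : e.hom ≫ p'.map = p.map) :
    ParEquiv Z p' q := by
  obtain ⟨Cm, C₁, C₂, γ₁, δ₁, γ₂, δ₂, h₁, h₂, hi, hm, ht₁, ht₂⟩ := h
  refine ⟨Cm, C₁, C₂, γ₁ ≫ e.hom, δ₁ ≫ e.hom, γ₂, δ₂, nonempty_isColimit_comp_iso h₁ e, h₂,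
    ?_, ?_, ?_, ht₂⟩
  · rwa [Category.assoc, hincl]
  · rwa [Category.assoc, hmap]
  · rwa [Category.assoc, hmap]

/-- Postcomposition with a total morphism can be computed without a pullback. -/
theorem parEquiv_comp_ofHom_iff [HasPullbacks C] {Z : Set C} {X Y W : C} (p : ParHom X Y)
    (g : Y ⟶ W) (q : ParHom X W) :
    ParEquiv Z (p.comp (ParHom.ofHom g)) q ↔ ParEquiv Z ⟨p.dom, p.incl, p.map ≫ g⟩ q := by
  have hcond : pullback.fst p.map (𝟙 Y) ≫ p.map = pullback.snd p.map (𝟙 Y) := by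
    simpa using pullback.condition (f := p.map) (g := 𝟙 Y)
  have : IsIso (pullback.fst p.map (𝟙 Y)) := pullback_fst_iso_of_right_iso _ _
  let i : pullback p.map (𝟙 Y) ≅ p.dom := asIso (pullback.fst p.map (𝟙 Y))
  let e : (p.comp (ParHom.ofHom g)).dom ≅ p.dom := i
  have hincl : e.hom ≫ p.incl = (p.comp (ParHom.ofHom g)).incl := rfl
  have hmap : e.hom ≫ p.map ≫ g = (p.comp (ParHom.ofHom g)).map := by
    rw [← Category.assoc]
    exact congrArg (· ≫ g) hcond
  exact ⟨fun h => h.of_iso_left e hincl hmap,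
    fun h => h.of_iso_left e.symm (e.inv_comp_eq.2 hincl.symm) (e.inv_comp_eq.2 hmap.symm)⟩

/-- A partial morphism is congruent to zero exactly when it is trivial on its domain. -/
theorem parEquiv_zero_iff [HasInitial C] [HasBinaryCoproducts C] {Z : Set C}
    (hZ : ∀ A B : C, A ∈ Z → B ∈ Z → (A ⨿ B) ∈ Z) (h0 : (⊥_ C) ∈ Z) {X Y : C} (p : ParHom X Y) :
    ParEquiv Z p (ParHom.zero X Y) ↔ IsTrivial Z p.map := by
  constructor
  · rintro ⟨Cm, C₁, C₂, γ₁, δ₁, γ₂, δ₂, ⟨h₁⟩, -, -, hm, ht, -⟩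
    refine isTrivial_of_isColimit hZ h₁ ?_ ht
    rw [hm]
    exact (isTrivial_of_mem h0 (initial.to Y)).precomp γ₂
  · intro h
    refine ⟨⊥_ C, p.dom, ⊥_ C, initial.to _, 𝟙 _, 𝟙 _, initial.to _,
      nonempty_isColimit_initial_id _, nonempty_isColimit_id_initial _,
      Subsingleton.elim _ _, Subsingleton.elim _ _, h.precomp _, isTrivial_of_mem h0 _⟩

/-- `Σ` sends `Z`-kernels to kernels in the stable category. -/
theorem sigma_sends_zkernels_to_kernels
    [FinitaryExtensive C] [HasFiniteLimits C] (P : PretorsionTheory C)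
    (hZcoprod : ∀ A B : C, A ∈ P.Z → B ∈ P.Z → (A ⨿ B) ∈ P.Z)
    (hZcompl : ∀ A B : C, (A ⨿ B) ∈ P.Z → A ∈ P.Z ∧ B ∈ P.Z)
    {K X Y : C} (k : K ⟶ X) (f : X ⟶ Y) (hk : IsZKernel P.Z k f) :
    IsStabKernel P.Z (ParHom.ofHom k) (ParHom.ofHom f) := by
  have h0 := P.initial_mem_Z hZcompl
  have := hk.mono
  refine ⟨?_, fun p hp hpf => ?_⟩
  · rw [parEquiv_comp_ofHom_iff, parEquiv_zero_iff hZcoprod h0]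
    exact hk.comp_trivial
  · rw [parEquiv_comp_ofHom_iff, parEquiv_zero_iff hZcoprod h0] at hpf
    obtain ⟨l, hl, -⟩ := hk.lift p.map hpf
    refine ⟨⟨p.dom, p.incl, l⟩, hp, ?_, fun u' _ hu' => ?_⟩
    · rw [parEquiv_comp_ofHom_iff]
      simp only [hl]
      exact ParEquiv.refl h0 p
    · rw [parEquiv_comp_ofHom_iff] at hu'
      obtain ⟨Cm, C₁, C₂, γ₁, δ₁, γ₂, δ₂, h₁, h₂, hi, hm, ht₁, ht₂⟩ := hu'
      refine ⟨Cm, C₁, C₂, γ₁, δ₁, γ₂, δ₂, h₁, h₂, hi, ?_, ?_, ?_⟩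
      · simpa [← cancel_mono k, hl] using hm
      · exact hk.isTrivial_of_comp (by simpa using ht₁)
      · exact hk.isTrivial_of_comp (by simpa [hl] using ht₂)
end PretorsionPaper
end
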